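/- Let V be a real inner product space and let R ⊆ V be a root system all of whose elements have square length 1 or 2. Then there do not exist vectors β, α₁, α₂, α₃, α₄ ∈ V such that: (i) the 16 vectors ε·αᵢ + ε′·β (1 ≤ i ≤ 4, ε, ε′ ∈ {1, −1}) are pairwise distinct and all lie in R; denote by W the set of these vectors and set S := R \ W; (ii) S is closed; (iii) ⟨β, αᵢ⟩ ≥ 0 for all i; (iv) β = α₁ + α₂ + α₃ and ⟨β, αᵢ⟩ = 1/4 for i = 1, 2, 3; (v) ⟨β, α₄⟩ = 0 and ‖α₄‖² = 1/4. -/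

import Mathlib

open scoped RealInnerProductSpace

/-- A root system in a real inner product space `V`: a finite set `R ⊆ V` with
`0 ∉ R` (R1), the only multiples of a root in `R` being `±` that root (R2),
integrality of `2⟨α,β⟩/⟨α,α⟩` (R3), and stability under reflections (R4). -/
def IsRootSystem {V : Type*} [NormedAddCommGroup V] [InnerProductSpace ℝ V]
    (R : Set V) : Prop :=
  R.Finite ∧ (0 : V) ∉ R ∧
  (∀ a ∈ R, ∀ t : ℝ, t • a ∈ R → t • a = a ∨ t • a = -a) ∧
  (∀ a ∈ R, ∀ b ∈ R, ∃ k : ℤ, 2 * ⟪a, b⟫ / ⟪a, a⟫ = (k : ℝ)) ∧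
  (∀ a ∈ R, ∀ b ∈ R, b - (2 * ⟪a, b⟫ / ⟪a, a⟫) • a ∈ R)

/-- `S` is a closed subset of the root system `R`: whenever `x, y ∈ S` and
`x + y ∈ R`, also `x + y ∈ S`. -/
def IsClosedIn {V : Type*} [NormedAddCommGroup V] [InnerProductSpace ℝ V]
    (R S : Set V) : Prop :=
  ∀ x ∈ S, ∀ y ∈ S, x + y ∈ R → x + y ∈ S

/-- If `a ± β` and `c + β` are roots of square length `1` or `2`, with the inner products below,
then `c ⟂ a`, and reflecting `c + β` in `β - a` shows that `c + a` is a root. -/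
lemma IsRootSystem.add_mem_of_inner_eq {V : Type*} [NormedAddCommGroup V] [InnerProductSpace ℝ V]
    {R : Set V} (hR : IsRootSystem R) (hlen : ∀ r ∈ R, ⟪r, r⟫ = 1 ∨ ⟪r, r⟫ = 2)
    {a β c : V} (hβ : ⟪β, β⟫ = 3 / 4) (ha : ⟪β, a⟫ = 1 / 4) (hc : ⟪β, c⟫ = 0)
    (hcc : ⟪c, c⟫ = 1 / 4) (hp : a + β ∈ R) (hm : β - a ∈ R) (hcβ : c + β ∈ R) :
    c + a ∈ R := by
  have ha' : ⟪a, β⟫ = 1 / 4 := by rw [real_inner_comm, ha]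
  have hc' : ⟪c, β⟫ = 0 := by rw [real_inner_comm, hc]
  have hpp : ⟪a + β, a + β⟫ = ⟪a, a⟫ + 5 / 4 := by
    simp only [inner_add_left, inner_add_right, hβ, ha, ha']; ring
  have hmm : ⟪β - a, β - a⟫ = ⟪a, a⟫ + 1 / 4 := by
    simp only [inner_sub_left, inner_sub_right, hβ, ha, ha']; ring
  have haa : ⟪a, a⟫ = 3 / 4 := by
    have h1 := hlen _ hp
    have h2 := hlen _ hm
    rw [hpp] at h1
    rw [hmm] at h2
    rcases h1 with h1 | h1 <;> rcases h2 with h2 | h2 <;> linarith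
  obtain ⟨-, -, -, hint, hrefl⟩ := hR
  have hac : ⟪a, c⟫ = 0 := by
    obtain ⟨k, hk⟩ := hint _ hp _ hcβ
    have hinner : ⟪a + β, c + β⟫ = ⟪a, c⟫ + 1 := by
      simp only [inner_add_left, inner_add_right, hβ, ha', hc]; ring
    rw [hpp, haa, hinner] at hk
    have hx : ⟪a, c⟫ = ((k - 1 : ℤ) : ℝ) := by push_cast; linarith
    have hcs := real_inner_mul_inner_self_le a c
    rw [haa, hcc, hx] at hcs
    have hlt : (k - 1) * (k - 1) < 1 := by
      have : (((k - 1) * (k - 1) : ℤ) : ℝ) < 1 := by push_cast at hcs ⊢; linarith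
      exact_mod_cast this
    have hk0 : k - 1 = 0 := by nlinarith
    rw [hx, hk0, Int.cast_zero]
  have hinner : ⟪β - a, c + β⟫ = 1 / 2 := by
    simp only [inner_sub_left, inner_add_right, hβ, ha', hc, hac]; norm_num
  have h := hrefl _ hm _ hcβ
  rw [hmm, haa, hinner] at h
  convert h using 1
  norm_num
  abel

theorem statement14 {V : Type*} [NormedAddCommGroup V] [InnerProductSpace ℝ V]
    (R : Set V) (hR : IsRootSystem R)
    (hlen : ∀ r ∈ R, ⟪r, r⟫ = 1 ∨ ⟪r, r⟫ = 2) :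
    ¬ ∃ (β : V) (α : Fin 4 → V) (W : Set V),
      W = {v | ∃ i : Fin 4, ∃ ε₁ ε₂ : ℝ,
        (ε₁ = 1 ∨ ε₁ = -1) ∧ (ε₂ = 1 ∨ ε₂ = -1) ∧ v = ε₁ • α i + ε₂ • β} ∧
      (∀ i j : Fin 4, ∀ ε₁ ε₂ η₁ η₂ : ℝ,
        (ε₁ = 1 ∨ ε₁ = -1) → (ε₂ = 1 ∨ ε₂ = -1) → (η₁ = 1 ∨ η₁ = -1) → (η₂ = 1 ∨ η₂ = -1) →
        ε₁ • α i + ε₂ • β = η₁ • α j + η₂ • β → i = j ∧ ε₁ = η₁ ∧ ε₂ = η₂) ∧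
      W ⊆ R ∧
      IsClosedIn R (R \ W) ∧
      (∀ i, 0 ≤ ⟪β, α i⟫) ∧
      β = α 0 + α 1 + α 2 ∧
      ⟪β, α 0⟫ = 1 / 4 ∧ ⟪β, α 1⟫ = 1 / 4 ∧ ⟪β, α 2⟫ = 1 / 4 ∧
      ⟪β, α 3⟫ = 0 ∧ ‖α 3‖ ^ 2 = 1 / 4 := by
  rintro ⟨β, α, W, hW, -, hWR, hcl, -, hsum, h0, h1, h2, h3, hn⟩
  have hβ : ⟪β, β⟫ = 3 / 4 := by
    nth_rewrite 2 [hsum]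
    rw [inner_add_right, inner_add_right, h0, h1, h2]; norm_num
  have hα3 : ⟪α 3, α 3⟫ = 1 / 4 := by rw [real_inner_self_eq_norm_sq, hn]
  have hmem : ∀ i, ∀ ε₁ ε₂ : ℝ, (ε₁ = 1 ∨ ε₁ = -1) → (ε₂ = 1 ∨ ε₂ = -1) →
      ε₁ • α i + ε₂ • β ∈ W := fun i ε₁ ε₂ hε₁ hε₂ => hW ▸ ⟨i, ε₁, ε₂, hε₁, hε₂, rfl⟩
  have hadd : ∀ i, α i + β ∈ W := fun i => by
    simpa using hmem i 1 1 (by simp) (by simp)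
  have hsub : ∀ i, β - α i ∈ W := fun i => by
    simpa [sub_eq_add_neg, add_comm] using hmem i (-1) 1 (by simp) (by simp)
  have hu : α 3 + α 0 ∈ R := hR.add_mem_of_inner_eq hlen hβ h0 h3 hα3
    (hWR (hadd 0)) (hWR (hsub 0)) (hWR (hadd 3))
  have hv : -α 3 + α 1 ∈ R := hR.add_mem_of_inner_eq hlen hβ h1
    (by rw [inner_neg_right, h3, neg_zero]) (by rw [inner_neg_neg, hα3])
    (hWR (hadd 1)) (hWR (hsub 1)) (by simpa [sub_eq_neg_add] using hWR (hsub 3))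
  have hnotW : ∀ w, ⟪β, w⟫ = 1 / 4 → w ∉ W := by
    intro w hw hwW
    rw [hW] at hwW
    obtain ⟨i, ε₁, ε₂, hε₁, hε₂, rfl⟩ := hwW
    rw [inner_add_right, inner_smul_right, inner_smul_right, hβ] at hw
    have hαi : ⟪β, α i⟫ = 1 / 4 ∨ ⟪β, α i⟫ = 0 := by
      fin_cases i
      exacts [.inl h0, .inl h1, .inl h2, .inr h3]
    rcases hαi with hαi | hαi <;> rw [hαi] at hw <;> rcases hε₁ with rfl | rfl <;>
      rcases hε₂ with rfl | rfl <;> norm_num at hw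
  have huv : (α 3 + α 0) + (-α 3 + α 1) ∈ W := by
    have h := hsub 2
    have heq : β - α 2 = (α 3 + α 0) + (-α 3 + α 1) := by rw [hsum]; abel
    rwa [heq] at h
  refine (hcl _ ⟨hu, hnotW _ ?_⟩ _ ⟨hv, hnotW _ ?_⟩ (hWR huv)).2 huv
  · rw [inner_add_right, h3, h0, zero_add]
  · rw [inner_add_right, inner_neg_right, h3, h1, neg_zero, zero_add]
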